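/- arXiv:2402.11120 — 5 statements merged into one kernel-verified Lean document; each statement's English description precedes it below -/
import Mathlib

section
/- For every hypothesis h in a nonempty hypothesis class H, the standard target loss is bounded as L(h; μ_T, f_T) ≤ L(h; μ_S, f_S) + (1/2)·d_{HΔH}(μ_S, μ_T) + γ((μ_S,f_S),(μ_T,f_T)). -/
open MeasureTheory

/-- The symmetric difference hypothesis class `HΔH`: functions of the form
`x ↦ h₁ x XOR h₂ x` with `h₁, h₂ ∈ H`.  Labels `Y = {0,1}` are modelled by `Bool`
(`true = 1`, `false = 0`). -/
def symmDiffClass {X : Type*} (H : Set (X → Bool)) : Set (X → Bool) :=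
  {g | ∃ h₁ ∈ H, ∃ h₂ ∈ H, g = fun x => xor (h₁ x) (h₂ x)}

/-- The standard (0-1) loss of hypothesis `h` on the domain `(μ, f)`:
`L(h; μ, f) = μ {x : h x ≠ f x}`. -/
noncomputable def stdLoss {X : Type*} [MeasurableSpace X] (μ : Measure X)
    (f h : X → Bool) : ℝ :=
  (μ {x | h x ≠ f x}).toReal

/-- The `HΔH`-divergence between two measures `μ, ν`:
`d_{HΔH}(μ, ν) = 2 · sup_{g ∈ HΔH} |μ {g = 1} − ν {g = 1}|`. -/
noncomputable def dHdH {X : Type*} [MeasurableSpace X] (H : Set (X → Bool))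
    (μ ν : Measure X) : ℝ :=
  2 * ⨆ g : symmDiffClass H,
    |(μ {x | g.1 x = true}).toReal - (ν {x | g.1 x = true}).toReal|

/-- The ideal joint loss `γ((μ_S,f_S),(μ_T,f_T)) = inf_{h ∈ H} [L(h;μ_S,f_S) + L(h;μ_T,f_T)]`. -/
noncomputable def idealJointLoss {X : Type*} [MeasurableSpace X] (H : Set (X → Bool))
    (μS : Measure X) (fS : X → Bool) (μT : Measure X) (fT : X → Bool) : ℝ :=
  ⨅ h : H, (stdLoss μS fS h.1 + stdLoss μT fT h.1)

theorem stdLoss_comm {X : Type*} [MeasurableSpace X] (μ : Measure X) (f g : X → Bool) :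
    stdLoss μ f g = stdLoss μ g f := by
  simp only [stdLoss, ne_comm]

theorem stdLoss_triangle {X : Type*} [MeasurableSpace X] (μ : Measure X) [IsFiniteMeasure μ]
    (f g h : X → Bool) : stdLoss μ f h ≤ stdLoss μ f g + stdLoss μ g h := by
  have hsub : {x | h x ≠ f x} ⊆ {x | g x ≠ f x} ∪ {x | h x ≠ g x} := by
    intro x hx
    by_contra hc
    simp_all
  exact (measureReal_mono hsub).trans (measureReal_union_le _ _)

theorem abs_stdLoss_sub_le_half_dHdH {X : Type*} [MeasurableSpace X] {H : Set (X → Bool)}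
    (μ ν : Measure X) [IsProbabilityMeasure μ] [IsProbabilityMeasure ν]
    {g h : X → Bool} (hg : g ∈ H) (hh : h ∈ H) :
    |stdLoss μ g h - stdLoss ν g h| ≤ (1 / 2) * dHdH H μ ν := by
  have hbdd : BddAbove (Set.range fun k : symmDiffClass H =>
      |(μ {x | k.1 x = true}).toReal - (ν {x | k.1 x = true}).toReal|) := by
    refine ⟨1, ?_⟩
    rintro _ ⟨k, rfl⟩
    exact abs_sub_le_of_nonneg_of_le measureReal_nonneg measureReal_le_one
      measureReal_nonneg measureReal_le_one
  have hle := le_ciSup hbdd ⟨fun x => xor (h x) (g x), h, hh, g, hg, rfl⟩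
  simp only [bne_iff_ne] at hle
  simpa [dHdH, stdLoss] using hle

/-- For every `h` in a nonempty class `H` of measurable hypotheses, the standard target
loss is bounded by the source loss, half the `HΔH`-divergence, and the ideal joint loss. -/
theorem target_loss_bound {X : Type*} [MeasurableSpace X] (H : Set (X → Bool))
    (hHne : H.Nonempty) (hHmeas : ∀ h ∈ H, Measurable h)
    (μS μT : Measure X) [IsProbabilityMeasure μS] [IsProbabilityMeasure μT]
    (fS fT : X → Bool) (hfS : Measurable fS) (hfT : Measurable fT)
    (h : X → Bool) (hh : h ∈ H) :
    stdLoss μT fT h ≤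
      stdLoss μS fS h + (1 / 2) * dHdH H μS μT + idealJointLoss H μS fS μT fT := by
  have : Nonempty H := hHne.to_subtype
  suffices hγ : stdLoss μT fT h - stdLoss μS fS h - (1 / 2) * dHdH H μS μT ≤
      idealJointLoss H μS fS μT fT by linarith
  refine le_ciInf fun k => ?_
  have hT := stdLoss_triangle μT fT k.1 h
  have hS := stdLoss_triangle μS k.1 fS h
  rw [stdLoss_comm μS k.1 fS] at hS
  have hd := neg_le_of_abs_le (abs_stdLoss_sub_le_half_dHdH μS μT k.2 hh)
  linarith
end

section
/- For every hypothesis h in a nonempty hypothesis class H, the supremum over admissible perturbation maps T of the perturbed target loss satisfies sup_T L(h; T) ≤ L(h; μ_S, f_S) + sup_T γ((μ_S,f_S), (T-perturbed target)) + (1/2)·d_adv(μ_S, μ_T), where for an admissible T the T-perturbed target domain has losses L(h'; T) = μ_T{x : h'(T(x)) ≠ f_T(x)} and γ((μ_S,f_S), (T-perturbed target)) = inf_{h' ∈ H}[L(h'; μ_S, f_S) + L(h'; T)]. -/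
open MeasureTheory

/-- An admissible perturbation map for the perturbation set `B`: a measurable map
`T` with `T x ∈ B x` for every `x`. -/
def IsAdmissible {X : Type*} [MeasurableSpace X] (B : X → Set X) (T : X → X) : Prop :=
  Measurable T ∧ ∀ x, T x ∈ B x

/-- The perturbed target loss of `h` under the perturbation map `T`:
`L(h; T) = μ_T {x : h (T x) ≠ f_T x}`. -/
noncomputable def pertLoss {X : Type*} [MeasurableSpace X] (μT : Measure X)
    (fT : X → Bool) (T : X → X) (h : X → Bool) : ℝ :=
  (μT {x | h (T x) ≠ fT x}).toReal

/-- The ideal joint loss of the source domain and the `T`-perturbed target domain: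
`γ((μ_S,f_S),(T-perturbed target)) = inf_{h' ∈ H}[L(h';μ_S,f_S) + L(h'; T)]`. -/
noncomputable def pertIdealJointLoss {X : Type*} [MeasurableSpace X]
    (H : Set (X → Bool)) (μS : Measure X) (fS : X → Bool)
    (μT : Measure X) (fT : X → Bool) (T : X → X) : ℝ :=
  ⨅ h' : H, (stdLoss μS fS h'.1 + pertLoss μT fT T h'.1)

/-- The adversarial `HΔH`-divergence
`d_adv(μ_S, μ_T) = 2 · sup_{g ∈ HΔH} |sup_T μ_T {x : g (T x) = 1} − μ_S {x : g x = 1}|`,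
the inner supremum over admissible perturbation maps `T`. -/
noncomputable def dAdv {X : Type*} [MeasurableSpace X] (H : Set (X → Bool))
    (B : X → Set X) (μS μT : Measure X) : ℝ :=
  2 * ⨆ g : symmDiffClass H,
    |(⨆ T : {T : X → X // IsAdmissible B T}, (μT {x | g.1 (T.1 x) = true}).toReal) -
      (μS {x | g.1 x = true}).toReal|

lemma measureReal_setOf_ne_le_add {Ω Y : Type*} [MeasurableSpace Ω] (μ : Measure Ω)
    [IsFiniteMeasure μ] (a b c : Ω → Y) :
    (μ {x | a x ≠ c x}).toReal ≤ (μ {x | a x ≠ b x}).toReal + (μ {x | b x ≠ c x}).toReal := by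
  have hsub : {x | a x ≠ c x} ⊆ {x | a x ≠ b x} ∪ {x | b x ≠ c x} := by
    intro x hx
    by_cases hab : a x = b x
    · exact Or.inr fun hbc => hx (hab.trans hbc)
    · exact Or.inl hab
  exact (measureReal_mono hsub).trans (measureReal_union_le _ _)

/-- Each perturbed target disagreement mass of two hypotheses exceeds their source disagreement
mass by at most half the adversarial divergence. -/
lemma pert_disagreement_le_add_dAdv {X : Type*} [MeasurableSpace X] {H : Set (X → Bool)}
    (B : X → Set X) (μS μT : Measure X) [IsProbabilityMeasure μS] [IsProbabilityMeasure μT]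
    {T : X → X} (hT : IsAdmissible B T) {h h' : X → Bool} (hh : h ∈ H) (hh' : h' ∈ H) :
    (μT {x | h (T x) ≠ h' (T x)}).toReal ≤
      (μS {x | h x ≠ h' x}).toReal + (1 / 2) * dAdv H B μS μT := by
  let p (g : X → Bool) (T : {T : X → X // IsAdmissible B T}) : ℝ :=
    (μT {x | g (T.1 x) = true}).toReal
  have hp (g) : BddAbove (Set.range (p g)) :=
    ⟨1, by rintro _ ⟨T, rfl⟩; exact measureReal_le_one⟩
  have hbdd : BddAbove (Set.range fun g : symmDiffClass H =>
      |(⨆ T, p g.1 T) - (μS {x | g.1 x = true}).toReal|) := by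
    refine ⟨1, ?_⟩
    rintro _ ⟨g, rfl⟩
    have h0 : 0 ≤ ⨆ T, p g.1 T := Real.iSup_nonneg fun _ => ENNReal.toReal_nonneg
    have h1 : ⨆ T, p g.1 T ≤ 1 := Real.iSup_le (fun _ => measureReal_le_one) zero_le_one
    have h2 : 0 ≤ (μS {x | g.1 x = true}).toReal := ENNReal.toReal_nonneg
    have h3 : (μS {x | g.1 x = true}).toReal ≤ 1 := measureReal_le_one
    exact abs_le.2 ⟨by linarith, by linarith⟩
  let g : symmDiffClass H := ⟨fun x => xor (h x) (h' x), h, hh, h', hh', rfl⟩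
  have hg (x : X) : g.1 x = true ↔ h x ≠ h' x := by simp [g]
  have hle := (le_abs_self _).trans (le_ciSup hbdd g)
  have hTle := le_ciSup (hp g.1) ⟨T, hT⟩
  simp only [p, hg] at hTle hle
  simp only [dAdv]
  linarith

/-- For every `h` in a nonempty class `H` of measurable hypotheses, the supremum over
admissible perturbation maps `T` of the perturbed target loss is bounded by the source
loss, the worst-case ideal joint loss, and half the adversarial `HΔH`-divergence. -/
theorem adv_target_loss_bound_dadv {X : Type*} [MeasurableSpace X]
    (H : Set (X → Bool)) (hHne : H.Nonempty) (hHmeas : ∀ h ∈ H, Measurable h)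
    (μS μT : Measure X) [IsProbabilityMeasure μS] [IsProbabilityMeasure μT]
    (fS fT : X → Bool) (hfS : Measurable fS) (hfT : Measurable fT)
    (B : X → Set X) (hB : ∀ x, x ∈ B x)
    (h : X → Bool) (hh : h ∈ H) :
    (⨆ T : {T : X → X // IsAdmissible B T}, pertLoss μT fT T.1 h) ≤
      stdLoss μS fS h +
        (⨆ T : {T : X → X // IsAdmissible B T}, pertIdealJointLoss H μS fS μT fT T.1) +
        (1 / 2) * dAdv H B μS μT := by
  have hbdd : BddAbove (Set.range fun T : {T : X → X // IsAdmissible B T} =>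
      pertIdealJointLoss H μS fS μT fT T.1) := by
    refine ⟨2, ?_⟩
    rintro _ ⟨T, rfl⟩
    have h0 : BddBelow (Set.range fun h' : H => stdLoss μS fS h'.1 + pertLoss μT fT T.1 h'.1) :=
      ⟨0, by rintro _ ⟨h', rfl⟩; exact add_nonneg ENNReal.toReal_nonneg ENNReal.toReal_nonneg⟩
    have h1 : stdLoss μS fS h ≤ 1 := measureReal_le_one
    have h2 : pertLoss μT fT T.1 h ≤ 1 := measureReal_le_one
    exact (ciInf_le h0 ⟨h, hh⟩).trans (by linarith)
  have : Nonempty {T : X → X // IsAdmissible B T} := ⟨⟨id, measurable_id, hB⟩⟩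
  have : Nonempty H := hHne.to_subtype
  refine ciSup_le fun T => ?_
  have hsup := le_ciSup hbdd T
  have hinf : pertLoss μT fT T.1 h - stdLoss μS fS h - (1 / 2) * dAdv H B μS μT ≤
      pertIdealJointLoss H μS fS μT fT T.1 := by
    refine le_ciInf fun h' => ?_
    have htarget := measureReal_setOf_ne_le_add μT
      (fun x => h (T.1 x)) (fun x => h'.1 (T.1 x)) fT
    have hsource := measureReal_setOf_ne_le_add μS h fS h'.1
    have hdiv := pert_disagreement_le_add_dAdv B μS μT T.2 hh h'.2
    simp only [ne_comm (a := fS _)] at hsource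
    simp only [stdLoss, pertLoss]
    linarith
  linarith
end

section
/- For every hypothesis h in a nonempty hypothesis class H, the supremum over admissible perturbation maps T of the perturbed target loss satisfies sup_T L(h; T) ≤ L(h; μ_S, f_S) + sup_T [ d_{HΔH}(μ_S, T_*μ_T) + 2·γ((μ_S,f_S), (T-perturbed target)) ], where T_*μ_T denotes the pushforward of μ_T under T, the T-perturbed target domain has losses L(h'; T) = μ_T{x : h'(T(x)) ≠ f_T(x)}, and γ((μ_S,f_S), (T-perturbed target)) = inf_{h' ∈ H}[L(h'; μ_S, f_S) + L(h'; T)]. -/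
open MeasureTheory

theorem measureReal_ne_triangle {X Y : Type*} [MeasurableSpace X] (μ : Measure X)
    [IsFiniteMeasure μ] (a b c : X → Y) :
    μ.real {x | a x ≠ c x} ≤ μ.real {x | a x ≠ b x} + μ.real {x | b x ≠ c x} := by
  refine (measureReal_mono ?_).trans (measureReal_union_le _ _)
  intro x hx
  by_cases hab : a x = b x
  · exact Or.inr fun hbc => hx (hab.trans hbc)
  · exact Or.inl hab

theorem abs_measureReal_sub_le_one {X ι : Type*} [MeasurableSpace X] (μ ν : Measure X)
    [IsProbabilityMeasure μ] [IsProbabilityMeasure ν] (s : ι → Set X) :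
    ∀ i, |μ.real (s i) - ν.real (s i)| ≤ 1 := by
  intro i
  have h₁ : μ.real (s i) ≤ 1 := measureReal_le_one
  have h₂ : ν.real (s i) ≤ 1 := measureReal_le_one
  have h₃ : 0 ≤ μ.real (s i) := measureReal_nonneg
  have h₄ : 0 ≤ ν.real (s i) := measureReal_nonneg
  rw [abs_le]
  constructor <;> linarith

theorem dHdH_nonneg {X : Type*} [MeasurableSpace X] (H : Set (X → Bool)) (μ ν : Measure X) :
    0 ≤ dHdH H μ ν :=
  mul_nonneg zero_le_two (Real.iSup_nonneg fun _ => abs_nonneg _)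

theorem dHdH_le_two {X : Type*} [MeasurableSpace X] (H : Set (X → Bool)) (μ ν : Measure X)
    [IsProbabilityMeasure μ] [IsProbabilityMeasure ν] : dHdH H μ ν ≤ 2 := by
  have hsup := Real.iSup_le (abs_measureReal_sub_le_one μ ν
    fun g : symmDiffClass H => {x | g.1 x = true}) zero_le_one
  simp only [measureReal_def] at hsup
  unfold dHdH
  linarith

theorem measureReal_ne_le_add_dHdH {X : Type*} [MeasurableSpace X] {H : Set (X → Bool)}
    (μ ν : Measure X) [IsProbabilityMeasure μ] [IsProbabilityMeasure ν]
    {h₁ h₂ : X → Bool} (hh₁ : h₁ ∈ H) (hh₂ : h₂ ∈ H) :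
    ν.real {x | h₁ x ≠ h₂ x} ≤ μ.real {x | h₁ x ≠ h₂ x} + dHdH H μ ν / 2 := by
  have hbdd : BddAbove (Set.range fun g : symmDiffClass H =>
      |μ.real {x | g.1 x = true} - ν.real {x | g.1 x = true}|) :=
    ⟨1, Set.forall_mem_range.2 (abs_measureReal_sub_le_one μ ν _)⟩
  have hle := le_ciSup hbdd ⟨fun x => xor (h₁ x) (h₂ x), h₁, hh₁, h₂, hh₂, rfl⟩
  simp only [measureReal_def, Bool.xor_iff_ne] at hle ⊢
  have habs := neg_le_of_abs_le hle
  unfold dHdH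
  linarith

theorem stdLoss_add_pertLoss_nonneg {X : Type*} [MeasurableSpace X] (μS μT : Measure X)
    (fS fT : X → Bool) (T : X → X) (h : X → Bool) :
    0 ≤ stdLoss μS fS h + pertLoss μT fT T h :=
  add_nonneg ENNReal.toReal_nonneg ENNReal.toReal_nonneg

theorem pertIdealJointLoss_nonneg {X : Type*} [MeasurableSpace X] (H : Set (X → Bool))
    (μS : Measure X) (fS : X → Bool) (μT : Measure X) (fT : X → Bool) (T : X → X) :
    0 ≤ pertIdealJointLoss H μS fS μT fT T :=
  Real.iInf_nonneg fun _ => stdLoss_add_pertLoss_nonneg _ _ _ _ _ _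

theorem pertIdealJointLoss_le_two {X : Type*} [MeasurableSpace X] {H : Set (X → Bool)}
    (hH : H.Nonempty) (μS μT : Measure X) [IsProbabilityMeasure μS] [IsProbabilityMeasure μT]
    (fS fT : X → Bool) (T : X → X) : pertIdealJointLoss H μS fS μT fT T ≤ 2 := by
  obtain ⟨h, hh⟩ := hH
  have hbdd : BddBelow (Set.range fun h' : H => stdLoss μS fS h'.1 + pertLoss μT fT T h'.1) :=
    ⟨0, Set.forall_mem_range.2 fun _ => stdLoss_add_pertLoss_nonneg _ _ _ _ _ _⟩
  refine (ciInf_le hbdd ⟨h, hh⟩).trans ?_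
  have hS : stdLoss μS fS h ≤ 1 := measureReal_le_one (μ := μS)
  have hT : pertLoss μT fT T h ≤ 1 := measureReal_le_one (μ := μT)
  linarith

/-- The domain adaptation bound for a single perturbation map. -/
theorem pertLoss_le {X : Type*} [MeasurableSpace X] {H : Set (X → Bool)}
    (hHmeas : ∀ h ∈ H, Measurable h) (μS μT : Measure X)
    [IsProbabilityMeasure μS] [IsProbabilityMeasure μT] (fS fT : X → Bool)
    {T : X → X} (hT : Measurable T) {h : X → Bool} (hh : h ∈ H) :
    pertLoss μT fT T h ≤ stdLoss μS fS h + dHdH H μS (μT.map T) / 2 +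
      pertIdealJointLoss H μS fS μT fT T := by
  have : IsProbabilityMeasure (μT.map T) := Measure.isProbabilityMeasure_map hT.aemeasurable
  have : Nonempty H := ⟨⟨h, hh⟩⟩
  rw [← sub_le_iff_le_add']
  refine le_ciInf fun ⟨h', hh'⟩ => ?_
  have htarget := measureReal_ne_triangle μT (fun x => h (T x)) (fun x => h' (T x)) fT
  have hsource := measureReal_ne_triangle μS h fS h'
  have hdiv := measureReal_ne_le_add_dHdH μS (μT.map T) hh hh'
  have hmeas : MeasurableSet {x | h x ≠ h' x} :=
    (measurableSet_eq_fun (hHmeas h hh) (hHmeas h' hh')).compl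
  rw [map_measureReal_apply hT hmeas, Set.preimage_ofPred_eq] at hdiv
  have hcomm : {x | fS x ≠ h' x} = {x | h' x ≠ fS x} := by
    simp only [ne_comm]
  rw [hcomm] at hsource
  simp only [stdLoss, pertLoss, ← measureReal_def]
  linarith

/-- For every `h` in a nonempty class `H` of measurable hypotheses,
`sup_T L(h;T) ≤ L(h;μ_S,f_S) + sup_T [ d_{HΔH}(μ_S, T_*μ_T) + 2·γ((μ_S,f_S),(T-perturbed target)) ]`,
where `T_*μ_T` is the pushforward of `μ_T` under `T`. -/
theorem adv_target_loss_bound_pushforward {X : Type*} [MeasurableSpace X]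
    (H : Set (X → Bool)) (hHne : H.Nonempty) (hHmeas : ∀ h ∈ H, Measurable h)
    (μS μT : Measure X) [IsProbabilityMeasure μS] [IsProbabilityMeasure μT]
    (fS fT : X → Bool) (hfS : Measurable fS) (hfT : Measurable fT)
    (B : X → Set X) (hB : ∀ x, x ∈ B x)
    (h : X → Bool) (hh : h ∈ H) :
    (⨆ T : {T : X → X // IsAdmissible B T}, pertLoss μT fT T.1 h) ≤
      stdLoss μS fS h +
        ⨆ T : {T : X → X // IsAdmissible B T},
          (dHdH H μS (μT.map T.1) + 2 * pertIdealJointLoss H μS fS μT fT T.1) := by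
  have : Nonempty {T : X → X // IsAdmissible B T} := ⟨⟨id, measurable_id, hB⟩⟩
  have hbdd : BddAbove (Set.range fun T : {T : X → X // IsAdmissible B T} =>
      dHdH H μS (μT.map T.1) + 2 * pertIdealJointLoss H μS fS μT fT T.1) := by
    refine ⟨6, Set.forall_mem_range.2 fun T => ?_⟩
    have : IsProbabilityMeasure (μT.map T.1) :=
      Measure.isProbabilityMeasure_map T.2.1.aemeasurable
    have hd := dHdH_le_two H μS (μT.map T.1)
    have hγ := pertIdealJointLoss_le_two hHne μS μT fS fT T.1
    linarith
  refine ciSup_le fun T => ?_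
  have hsup := le_ciSup hbdd T
  have hloss := pertLoss_le hHmeas μS μT fS fT T.2.1 hh
  have hd := dHdH_nonneg H μS (μT.map T.1)
  have hγ := pertIdealJointLoss_nonneg H μS fS μT fT T.1
  linarith
end

section
/- Suppose H is nonempty and HΔH is closed under pointwise complement (i.e., for every g ∈ HΔH, the function x ↦ 1 − g(x) is also in HΔH). Then for unlabeled samples X_S = (x_1^s,…,x_n^s) and X_T = (x_1^t,…,x_n^t) in X^n (n ≥ 1), the empirical HΔH-divergence satisfies d_{HΔH}(X_S, X_T) = 2·(1 − inf_{g ∈ HΔH} [ (1/n)·Σ_i 1{g(x_i^s)=0} + (1/n)·Σ_i 1{g(x_i^t)=1} ]). -/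
open MeasureTheory

/-- Empirical `HΔH`-divergence between unlabeled samples `xs` and `ys` of size `n`:
`2 · sup_{g ∈ HΔH} |(1/n)·Σ_i 1{g(xs i)=1} − (1/n)·Σ_i 1{g(ys i)=1}|`. -/
noncomputable def dHdHEmp {X : Type*} {n : ℕ} (H : Set (X → Bool))
    (xs ys : Fin n → X) : ℝ :=
  2 * ⨆ g : symmDiffClass H,
    |(1 / (n : ℝ)) * ∑ i, (if g.1 (xs i) = true then (1 : ℝ) else 0) -
      (1 / (n : ℝ)) * ∑ i, (if g.1 (ys i) = true then (1 : ℝ) else 0)|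

/-- The empirical frequencies of the two labels sum to one. -/
lemma empirical_freq_false_eq {X : Type*} {n : ℕ} (hn : 1 ≤ n) (g : X → Bool) (zs : Fin n → X) :
    (1 / (n : ℝ)) * ∑ i, (if g (zs i) = false then (1 : ℝ) else 0) =
      1 - (1 / (n : ℝ)) * ∑ i, (if g (zs i) = true then (1 : ℝ) else 0) := by
  have hn' : (n : ℝ) ≠ 0 := by exact_mod_cast (by omega : n ≠ 0)
  have h : ∑ i, (if g (zs i) = false then (1 : ℝ) else 0) +
      ∑ i, (if g (zs i) = true then (1 : ℝ) else 0) = n := by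
    rw [← Finset.sum_add_distrib]
    have : ∀ i, (if g (zs i) = false then (1 : ℝ) else 0) +
        (if g (zs i) = true then (1 : ℝ) else 0) = 1 := by
      intro i
      cases g (zs i) <;> simp
    simp [this]
  rw [eq_sub_iff_add_eq, ← mul_add, h, one_div, inv_mul_cancel₀ hn']

/-- An empirical frequency is nonnegative. -/
lemma empirical_freq_nonneg {X : Type*} {n : ℕ} (g : X → Bool) (zs : Fin n → X) (b : Bool) :
    0 ≤ (1 / (n : ℝ)) * ∑ i, (if g (zs i) = b then (1 : ℝ) else 0) :=
  mul_nonneg (by positivity) (Finset.sum_nonneg fun i _ => by split_ifs <;> norm_num)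

/-- If `f` takes values in `[0, 2]` and its range is stable under `t ↦ 2 - t`, then the largest
deviation of `f` from `1` is attained below `1`. -/
lemma iSup_abs_one_sub_eq_one_sub_iInf {ι : Type*} [Nonempty ι] (f : ι → ℝ)
    (h_nonneg : ∀ i, 0 ≤ f i) (h_le : ∀ i, f i ≤ 2) (h_refl : ∀ i, ∃ j, f j = 2 - f i) :
    ⨆ i, |1 - f i| = 1 - ⨅ i, f i := by
  have hbelow : BddBelow (Set.range f) := ⟨0, by rintro _ ⟨i, rfl⟩; exact h_nonneg i⟩
  have habove : BddAbove (Set.range fun i => |1 - f i|) := by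
    refine ⟨1, ?_⟩
    rintro _ ⟨i, rfl⟩
    exact abs_le.2 ⟨by linarith [h_le i], by linarith [h_nonneg i]⟩
  apply le_antisymm
  · refine ciSup_le fun i => abs_le.2 ⟨?_, ?_⟩
    · obtain ⟨j, hj⟩ := h_refl i
      linarith [ciInf_le hbelow j]
    · linarith [ciInf_le hbelow i]
  · rw [sub_le_comm]
    refine le_ciInf fun i => ?_
    linarith [le_ciSup habove i, le_abs_self (1 - f i)]

/-- If `H` is nonempty and `HΔH` is closed under pointwise complement, then the
empirical `HΔH`-divergence can be computed as
`2·(1 − inf_{g ∈ HΔH} [(1/n)·Σ_i 1{g(xs i)=0} + (1/n)·Σ_i 1{g(ys i)=1}])`. -/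
theorem dHdHEmp_eq_two_sub_inf {X : Type*} [MeasurableSpace X] {n : ℕ} (hn : 1 ≤ n)
    (H : Set (X → Bool)) (hHne : H.Nonempty) (hHmeas : ∀ h ∈ H, Measurable h)
    (hcompl : ∀ g ∈ symmDiffClass H, (fun x => !(g x)) ∈ symmDiffClass H)
    (xs ys : Fin n → X) :
    dHdHEmp H xs ys =
      2 * (1 - ⨅ g : symmDiffClass H,
        ((1 / (n : ℝ)) * ∑ i, (if g.1 (xs i) = false then (1 : ℝ) else 0) +
          (1 / (n : ℝ)) * ∑ i, (if g.1 (ys i) = true then (1 : ℝ) else 0))) := by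
  obtain ⟨h₀, hh₀⟩ := hHne
  have : Nonempty (symmDiffClass H) := ⟨⟨_, h₀, hh₀, h₀, hh₀, rfl⟩⟩
  unfold dHdHEmp
  rw [← iSup_abs_one_sub_eq_one_sub_iInf]
  · congr 2
    funext g
    rw [empirical_freq_false_eq hn g.1 xs]
    congr 1
    ring
  · exact fun g => add_nonneg (empirical_freq_nonneg _ _ _) (empirical_freq_nonneg _ _ _)
  · intro g
    linarith [empirical_freq_false_eq hn g.1 xs, empirical_freq_false_eq hn g.1 ys,
      empirical_freq_nonneg g.1 xs true, empirical_freq_nonneg g.1 ys false]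
  · intro g
    refine ⟨⟨_, hcompl g.1 g.2⟩, ?_⟩
    simp only [Bool.not_eq_false', Bool.not_eq_true']
    linarith [empirical_freq_false_eq hn g.1 xs, empirical_freq_false_eq hn g.1 ys]
end

section
/- Deterministic core of the main generalization bound: let H be nonempty, let (μ_S, f_S) and (μ_T, f_T) be source and target domains, let Z_S = ((x_i^s, y_i^s))_{i=1}^n be a labeled source sample and X_T = (x_1^t,…,x_n^t) an unlabeled target sample with induced labels y_i^t = f_T(x_i^t), and let ε ≥ 0. Assume the following four deviation bounds hold: (i) sup_{h ∈ H} |L(h; μ_S, f_S) − L̂(h; Z_S)| ≤ ε/4; (ii) 2·sup_{g ∈ HΔH} |μ_S{x : g(x)=1} − (1/n)·Σ_i 1{g(x_i^s)=1}| ≤ ε/4; (iii) 2·sup_{g ∈ HΔH} | sup_T μ_T{x : g(T(x))=1} − (1/n)·Σ_i sup_{x̃ ∈ B(x_i^t)} 1{g(x̃)=1} | ≤ ε/4, the inner supremum over admissible perturbation maps T; (iv) for every admissible perturbation map T, |γ((μ_S,f_S), (T-perturbed target)) − γ̂(Z_S, Z_T^T)| ≤ ε/4, where Z_T^T = ((T(x_i^t),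 y_i^t))_{i=1}^n and the T-perturbed target domain has losses L(h'; T) = μ_T{x : h'(T(x)) ≠ f_T(x)}. Then for every h ∈ H: sup_T L(h; T) ≤ L̂(h; Z_S) + sup_{X̃_T} [ d_{HΔH}(X_S, X̃_T) + 2·γ̂(Z_S, Z̃_T) ] + ε, where the last supremum is over perturbed samples X̃_T = (x̃_1,…,x̃_n) with x̃_i ∈ B(x_i^t), Z̃_T = ((x̃_i, y_i^t))_{i=1}^n, and X_S = (x_1^s,…,x_n^s). -/
open MeasureTheory

/-- The 0-1 loss on labels `Y = {0,1}` (modelled by `Bool`, `true = 1`, `false = 0`):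
`ℓ(y, y') = 1` if `y ≠ y'` and `0` otherwise. -/
noncomputable def loss01 (y y' : Bool) : ℝ := if y = y' then 0 else 1

/-- Empirical loss of `h` on the labeled sample `Z`: `(1/n)·Σ_i ℓ(h(x_i), y_i)`. -/
noncomputable def empLoss {X : Type*} {n : ℕ} (h : X → Bool) (Z : Fin n → X × Bool) : ℝ :=
  (1 / (n : ℝ)) * ∑ i, loss01 (h (Z i).1) (Z i).2

/-- Empirical ideal joint loss `γ̂(Z_S, Z') = inf_{h ∈ H}[L̂(h;Z_S) + L̂(h;Z')]`. -/
noncomputable def empIdealJointLoss {X : Type*} {n : ℕ} (H : Set (X → Bool))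
    (ZS Z' : Fin n → X × Bool) : ℝ :=
  ⨅ h : H, (empLoss h.1 ZS + empLoss h.1 Z')

/-- The average of numbers in `[0, 1]` is in `[0, 1]`. -/
theorem average_mem_Icc {n : ℕ} {a : Fin n → ℝ} (ha : ∀ i, a i ∈ Set.Icc (0 : ℝ) 1) :
    (1 / (n : ℝ)) * ∑ i, a i ∈ Set.Icc (0 : ℝ) 1 := by
  have hle : ∑ i, a i ≤ n := by
    simpa using Finset.sum_le_sum fun i (_ : i ∈ Finset.univ) => (ha i).2
  refine ⟨mul_nonneg (by positivity) (Finset.sum_nonneg fun i _ => (ha i).1), ?_⟩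
  rw [one_div_mul_eq_div]
  exact div_le_one_of_le₀ hle (by positivity)

theorem ite_one_zero_mem_Icc (p : Prop) [Decidable p] :
    (if p then (1 : ℝ) else 0) ∈ Set.Icc (0 : ℝ) 1 := by
  split_ifs <;> simp

theorem abs_sub_le_one_of_mem_Icc {a b : ℝ} (ha : a ∈ Set.Icc (0 : ℝ) 1)
    (hb : b ∈ Set.Icc (0 : ℝ) 1) : |a - b| ≤ 1 :=
  abs_le.2 ⟨by linarith [ha.1, hb.2], by linarith [ha.2, hb.1]⟩

/-- The absolute difference of two `[0, 1]`-valued families is bounded by its supremum. -/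
theorem abs_sub_le_iSup_of_mem_Icc {ι : Type*} {a b : ι → ℝ} (ha : ∀ i, a i ∈ Set.Icc (0 : ℝ) 1)
    (hb : ∀ i, b i ∈ Set.Icc (0 : ℝ) 1) (i : ι) : |a i - b i| ≤ ⨆ j, |a j - b j| :=
  le_ciSup (f := fun j => |a j - b j|)
    ⟨1, Set.forall_mem_range.2 fun j => abs_sub_le_one_of_mem_Icc (ha j) (hb j)⟩ i

theorem iSup_mem_Icc_of_mem_Icc {ι : Type*} {a : ι → ℝ} (ha : ∀ i, a i ∈ Set.Icc (0 : ℝ) 1) :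
    ⨆ i, a i ∈ Set.Icc (0 : ℝ) 1 :=
  ⟨Real.iSup_nonneg fun i => (ha i).1, Real.iSup_le (fun i => (ha i).2) zero_le_one⟩

theorem measure_toReal_mem_Icc {X : Type*} [MeasurableSpace X] (μ : Measure X)
    [IsProbabilityMeasure μ] (s : Set X) : (μ s).toReal ∈ Set.Icc (0 : ℝ) 1 :=
  ⟨ENNReal.toReal_nonneg, measureReal_le_one⟩

/-- Subadditivity of a finite measure, for a set covered by two others. -/
theorem measure_toReal_le_add {X : Type*} [MeasurableSpace X] (μ : Measure X)
    [IsFiniteMeasure μ] {s t u : Set X} (hstu : s ⊆ t ∪ u) :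
    (μ s).toReal ≤ (μ t).toReal + (μ u).toReal :=
  (measureReal_mono hstu).trans (measureReal_union_le t u)

theorem empLoss_mem_Icc {X : Type*} {n : ℕ} (h : X → Bool) (Z : Fin n → X × Bool) :
    empLoss h Z ∈ Set.Icc (0 : ℝ) 1 := by
  refine average_mem_Icc fun i => ?_
  unfold loss01
  split_ifs <;> simp

theorem empIdealJointLoss_nonneg {X : Type*} {n : ℕ} (H : Set (X → Bool))
    (Z Z' : Fin n → X × Bool) : 0 ≤ empIdealJointLoss H Z Z' :=
  Real.iInf_nonneg fun h => add_nonneg (empLoss_mem_Icc h.1 Z).1 (empLoss_mem_Icc h.1 Z').1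

theorem empIdealJointLoss_le_two {X : Type*} {n : ℕ} {H : Set (X → Bool)} (hH : H.Nonempty)
    (Z Z' : Fin n → X × Bool) : empIdealJointLoss H Z Z' ≤ 2 := by
  obtain ⟨h, hh⟩ := hH
  refine (ciInf_le (f := fun h : H => empLoss h.1 Z + empLoss h.1 Z') ⟨0, ?_⟩ ⟨h, hh⟩).trans ?_
  · exact Set.forall_mem_range.2 fun h =>
      add_nonneg (empLoss_mem_Icc h.1 Z).1 (empLoss_mem_Icc h.1 Z').1
  · linarith [(empLoss_mem_Icc h Z).2, (empLoss_mem_Icc h Z').2]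

theorem dHdHEmp_nonneg {X : Type*} {n : ℕ} (H : Set (X → Bool)) (xs ys : Fin n → X) :
    0 ≤ dHdHEmp H xs ys :=
  mul_nonneg zero_le_two (Real.iSup_nonneg fun _ => abs_nonneg _)

theorem dHdHEmp_le_two {X : Type*} {n : ℕ} (H : Set (X → Bool)) (xs ys : Fin n → X) :
    dHdHEmp H xs ys ≤ 2 := by
  have hsup : (⨆ g : symmDiffClass H,
      |(1 / (n : ℝ)) * ∑ i, (if g.1 (xs i) = true then (1 : ℝ) else 0) -
        (1 / (n : ℝ)) * ∑ i, (if g.1 (ys i) = true then (1 : ℝ) else 0)|) ≤ 1 :=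
    Real.iSup_le (fun g => abs_sub_le_one_of_mem_Icc
      (average_mem_Icc fun i => ite_one_zero_mem_Icc _)
      (average_mem_Icc fun i => ite_one_zero_mem_Icc _)) zero_le_one
  unfold dHdHEmp
  linarith

/-- The supremum of the indicator of `g` over a nonempty set is attained. -/
theorem exists_iSup_indicator_le {X : Type*} (g : X → Bool) {s : Set X} (hs : s.Nonempty) :
    ∃ y ∈ s, (⨆ x : s, if g x.1 = true then (1 : ℝ) else 0) ≤ if g y = true then 1 else 0 := by
  by_cases hg : ∃ y ∈ s, g y = true
  · obtain ⟨y, hy, hgy⟩ := hg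
    refine ⟨y, hy, ?_⟩
    rw [if_pos hgy]
    exact Real.iSup_le (fun x => (ite_one_zero_mem_Icc _).2) zero_le_one
  · obtain ⟨y, hy⟩ := hs
    refine ⟨y, hy, Real.iSup_le (fun x => ?_) (ite_one_zero_mem_Icc _).1⟩
    rw [if_neg fun hx => hg ⟨x.1, x.2, hx⟩]
    exact (ite_one_zero_mem_Icc _).1

/-- Deterministic core of the main generalization bound (Theorem 3.1): under the four
deviation bounds (i)–(iv), for every `h ∈ H` the worst-case perturbed target loss is
bounded by the empirical source loss, the worst-case (over perturbed samples) empirical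
divergence plus twice the empirical ideal joint loss, and `ε`. -/
theorem main_generalization_bound_core {X : Type*} [MeasurableSpace X] {n : ℕ}
    (hn : 1 ≤ n)
    (H : Set (X → Bool)) (hHne : H.Nonempty) (hHmeas : ∀ h ∈ H, Measurable h)
    (μS μT : Measure X) [IsProbabilityMeasure μS] [IsProbabilityMeasure μT]
    (fS fT : X → Bool) (hfS : Measurable fS) (hfT : Measurable fT)
    (B : X → Set X) (hB : ∀ x, x ∈ B x)
    (ZS : Fin n → X × Bool) (xt : Fin n → X)
    (ε : ℝ) (hε : 0 ≤ ε)
    -- (i) uniform deviation of the source loss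
    (hi : (⨆ h : H, |stdLoss μS fS h.1 - empLoss h.1 ZS|) ≤ ε / 4)
    -- (ii) deviation of the source `HΔH`-divergence term
    (hii : 2 * (⨆ g : symmDiffClass H,
        |(μS {x | g.1 x = true}).toReal -
          (1 / (n : ℝ)) * ∑ i, (if g.1 ((ZS i).1) = true then (1 : ℝ) else 0)|) ≤ ε / 4)
    -- (iii) deviation of the adversarial target `HΔH`-divergence term
    (hiii : 2 * (⨆ g : symmDiffClass H,
        |(⨆ T : {T : X → X // IsAdmissible B T}, (μT {x | g.1 (T.1 x) = true}).toReal) -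
          (1 / (n : ℝ)) * ∑ i, (⨆ x' : B (xt i), if g.1 x'.1 = true then (1 : ℝ) else 0)|)
        ≤ ε / 4)
    -- (iv) deviation of the ideal joint loss, uniformly over admissible `T`
    (hiv : ∀ T : X → X, IsAdmissible B T →
        |pertIdealJointLoss H μS fS μT fT T -
          empIdealJointLoss H ZS (fun i => (T (xt i), fT (xt i)))| ≤ ε / 4)
    (h : X → Bool) (hh : h ∈ H) :
    (⨆ T : {T : X → X // IsAdmissible B T}, pertLoss μT fT T.1 h) ≤
      empLoss h ZS +
        (⨆ xt' : {v : Fin n → X // ∀ i, v i ∈ B (xt i)},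
          (dHdHEmp H (fun i => (ZS i).1) xt'.1 +
            2 * empIdealJointLoss H ZS (fun i => (xt'.1 i, fT (xt i))))) + ε := by
  set V := {v : Fin n → X // ∀ i, v i ∈ B (xt i)}
  set F : V → ℝ := fun v => dHdHEmp H (fun i => (ZS i).1) v.1 +
    2 * empIdealJointLoss H ZS (fun i => (v.1 i, fT (xt i))) with hF
  have hFM : ∀ v : V, F v ≤ ⨆ v, F v := by
    refine le_ciSup ⟨6, Set.forall_mem_range.2 fun v => ?_⟩
    have h₁ := dHdHEmp_le_two H (fun i => (ZS i).1) v.1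
    have h₂ := empIdealJointLoss_le_two hHne ZS (fun i => (v.1 i, fT (xt i)))
    simp only [hF]
    linarith
  have : Nonempty {T : X → X // IsAdmissible B T} := ⟨⟨id, measurable_id, hB⟩⟩
  have : Nonempty H := hHne.to_subtype
  refine ciSup_le fun T => le_of_forall_pos_le_add fun η hη => ?_
  obtain ⟨⟨h', hh'⟩, hopt⟩ := exists_lt_of_ciInf_lt
    (lt_add_of_pos_right (pertIdealJointLoss H μS fS μT fT T.1) hη)
  set g : X → Bool := fun x => xor (h x) (h' x) with hg
  have hgmem : g ∈ symmDiffClass H := ⟨h, hh, h', hh', rfl⟩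
  choose v hvB hv using fun i => exists_iSup_indicator_le g ⟨xt i, hB (xt i)⟩
  have hsource := (abs_sub_le_iSup_of_mem_Icc
    (a := fun h : H => stdLoss μS fS h.1) (b := fun h : H => empLoss h.1 ZS)
    (fun h => measure_toReal_mem_Icc _ _) (fun h => empLoss_mem_Icc _ _) ⟨h, hh⟩).trans hi
  have hdivS := abs_sub_le_iSup_of_mem_Icc
    (a := fun g : symmDiffClass H => (μS {x | g.1 x = true}).toReal)
    (b := fun g : symmDiffClass H =>
      (1 / (n : ℝ)) * ∑ i, (if g.1 ((ZS i).1) = true then (1 : ℝ) else 0))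
    (fun g => measure_toReal_mem_Icc _ _)
    (fun g => average_mem_Icc fun i => ite_one_zero_mem_Icc _) ⟨g, hgmem⟩
  have hdivT := abs_sub_le_iSup_of_mem_Icc
    (a := fun g : symmDiffClass H =>
      ⨆ T : {T : X → X // IsAdmissible B T}, (μT {x | g.1 (T.1 x) = true}).toReal)
    (b := fun g : symmDiffClass H =>
      (1 / (n : ℝ)) * ∑ i, (⨆ x' : B (xt i), if g.1 x'.1 = true then (1 : ℝ) else 0))
    (fun g => iSup_mem_Icc_of_mem_Icc fun T => measure_toReal_mem_Icc _ _)
    (fun g => average_mem_Icc fun i => iSup_mem_Icc_of_mem_Icc fun x => ite_one_zero_mem_Icc _)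
    ⟨g, hgmem⟩
  have hdiv := abs_sub_le_iSup_of_mem_Icc
    (a := fun g : symmDiffClass H =>
      (1 / (n : ℝ)) * ∑ i, (if g.1 ((ZS i).1) = true then (1 : ℝ) else 0))
    (b := fun g : symmDiffClass H =>
      (1 / (n : ℝ)) * ∑ i, (if g.1 (v i) = true then (1 : ℝ) else 0))
    (fun g => average_mem_Icc fun i => ite_one_zero_mem_Icc _)
    (fun g => average_mem_Icc fun i => ite_one_zero_mem_Icc _) ⟨g, hgmem⟩
  have hd : dHdHEmp H (fun i => (ZS i).1) v = 2 * ⨆ g : symmDiffClass H,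
    |(1 / (n : ℝ)) * ∑ i, (if g.1 ((ZS i).1) = true then (1 : ℝ) else 0) -
      (1 / (n : ℝ)) * ∑ i, (if g.1 (v i) = true then (1 : ℝ) else 0)| := rfl
  have hT : (μT {x | g (T.1 x) = true}).toReal ≤
      ⨆ T : {T : X → X // IsAdmissible B T}, (μT {x | g (T.1 x) = true}).toReal :=
    le_ciSup (f := fun T : {T : X → X // IsAdmissible B T} =>
      (μT {x | g (T.1 x) = true}).toReal)
      ⟨1, Set.forall_mem_range.2 fun T => (measure_toReal_mem_Icc _ _).2⟩ T
  have hworst : (1 / (n : ℝ)) * ∑ i, (⨆ x' : B (xt i), if g x'.1 = true then (1 : ℝ) else 0) ≤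
      (1 / (n : ℝ)) * ∑ i, (if g (v i) = true then (1 : ℝ) else 0) :=
    mul_le_mul_of_nonneg_left (Finset.sum_le_sum fun i _ => hv i) (by positivity)
  have htriT : pertLoss μT fT T.1 h ≤
      pertLoss μT fT T.1 h' + (μT {x | g (T.1 x) = true}).toReal := by
    refine measure_toReal_le_add μT fun x hx => ?_
    simp only [Set.mem_union, Set.mem_ofPred_eq, hg] at hx ⊢
    revert hx
    cases h (T.1 x) <;> cases h' (T.1 x) <;> cases fT x <;> simp
  have htriS : (μS {x | g x = true}).toReal ≤ stdLoss μS fS h + stdLoss μS fS h' := by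
    refine measure_toReal_le_add μS fun x hx => ?_
    simp only [Set.mem_union, Set.mem_ofPred_eq, hg] at hx ⊢
    revert hx
    cases h x <;> cases h' x <;> cases fS x <;> simp
  have hjoint := hiv T.1 T.2
  have hMv := hFM ⟨v, hvB⟩
  have hMT := hFM ⟨fun i => T.1 (xt i), fun i => T.2.2 (xt i)⟩
  simp only [hF] at hMv hMT
  have hγv := empIdealJointLoss_nonneg H ZS (fun i => (v i, fT (xt i)))
  have hdT := dHdHEmp_nonneg H (fun i => (ZS i).1) (fun i => T.1 (xt i))
  simp only at hsource hdivS hdivT hdiv hopt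
  have h₁ := (abs_le.1 hsource).2
  have h₂ := neg_le_of_abs_le hdivS
  have h₃ := le_of_abs_le hdivT
  have h₄ := neg_le_of_abs_le hdiv
  have h₅ := le_of_abs_le hjoint
  linarith
end
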